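/- Let (V₀, V₁, E) be a (w₀, w₁)-regular finite bipartite graph that is a 1-sided (c, ε)-lossless expander from V₀ to V₁, and assume ε·w₀ ≥ 1. Then for every subset v₁ ⊆ V₁ with |v₁| < c·|V₀|/w₁ there exist functions d¹, d² : V₀ → ℝ with d¹(x₀) ≥ 0 and d²(x₀) ≥ 0 for all x₀, such that: (i) d¹(x₀) + d²(x₀) = deg_{v₁}(x₀) for all x₀ ∈ V₀; (ii) Σ_{x₀ ∈ V₀} d¹(x₀) ≤ |v₁|; (iii) d²(x₀) ≤ ε·w₀ for all x₀ ∈ V₀; and (iv) Σ_{x₀ ∈ V₀} d²(x₀) ≤ w₁·|v₁|. -/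

import Mathlib

/-- Neighborhood of a set `S ⊆ V₀` in a bipartite graph with edge set `E ⊆ V₀ × V₁`. -/
def Nbhd {V₀ V₁ : Type*} (E : Set (V₀ × V₁)) (S : Set V₀) : Set V₁ :=
  {x₁ | ∃ x₀ ∈ S, (x₀, x₁) ∈ E}

/-- Every left vertex has exactly `w₀` neighbors. -/
def LeftRegular {V₀ V₁ : Type*} (E : Set (V₀ × V₁)) (w₀ : ℕ) : Prop :=
  ∀ x₀ : V₀, Nat.card {x₁ : V₁ | (x₀, x₁) ∈ E} = w₀

/-- Every right vertex has exactly `w₁` neighbors. -/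
def RightRegular {V₀ V₁ : Type*} (E : Set (V₀ × V₁)) (w₁ : ℕ) : Prop :=
  ∀ x₁ : V₁, Nat.card {x₀ : V₀ | (x₀, x₁) ∈ E} = w₁

/-- Degree of `x₀` into a subset `T ⊆ V₁`. -/
noncomputable def degIn {V₀ V₁ : Type*} (E : Set (V₀ × V₁)) (T : Set V₁) (x₀ : V₀) : ℕ :=
  Nat.card {x₁ : V₁ | x₁ ∈ T ∧ (x₀, x₁) ∈ E}

/-- degree-splitting lemma for lossless expanders:
`deg_{v₁}` splits as `d1 + d2` with `Σ d1 ≤ |v₁|`, `d2 ≤ ε·w₀` pointwise and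
`Σ d2 ≤ w₁·|v₁|`. -/
theorem lossless_degree_split
    (V₀ V₁ : Type) [Fintype V₀] [Fintype V₁] (E : Set (V₀ × V₁))
    (w₀ w₁ : ℕ) (hreg₀ : LeftRegular E w₀) (hreg₁ : RightRegular E w₁)
    (c ε : ℝ)
    (hlossless : ∀ S : Set V₀, (Nat.card S : ℝ) < c * Nat.card V₀ →
      (1 - ε) * (w₀ : ℝ) * (Nat.card S : ℝ) ≤ (Nat.card (Nbhd E S) : ℝ))
    (hεw : 1 ≤ ε * w₀) :
    ∀ v₁ : Set V₁, (Nat.card v₁ : ℝ) < c * Nat.card V₀ / w₁ →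
      ∃ d1 d2 : V₀ → ℝ,
        (∀ x₀, 0 ≤ d1 x₀) ∧ (∀ x₀, 0 ≤ d2 x₀) ∧
        (∀ x₀, d1 x₀ + d2 x₀ = (degIn E v₁ x₀ : ℝ)) ∧
        (∑ x₀ : V₀, d1 x₀) ≤ (Nat.card v₁ : ℝ) ∧
        (∀ x₀, d2 x₀ ≤ ε * w₀) ∧
        (∑ x₀ : V₀, d2 x₀) ≤ (w₁ : ℝ) * (Nat.card v₁ : ℝ) := by
  classical
  intro v₁ hv
  have hw1 : (0:ℝ) < w₁ := by
    rcases Nat.eq_zero_or_pos w₁ with h | h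
    · subst h
      simp only [Nat.cast_zero, div_zero] at hv
      exact absurd hv (not_lt.mpr (Nat.cast_nonneg _))
    · exact_mod_cast h
  have hv' : (w₁ : ℝ) * (Nat.card v₁ : ℝ) < c * Nat.card V₀ := by
    rw [lt_div_iff₀ hw1] at hv
    linarith
  have hdeg : ∀ x, degIn E v₁ x
      = (Finset.univ.filter (fun y : V₁ => y ∈ v₁ ∧ (x, y) ∈ E)).card := by
    intro x
    unfold degIn
    rw [Nat.card_eq_fintype_card, ← Set.toFinset_card]
    congr 1
    ext y
    simp
  have hcv : Nat.card v₁ = (Finset.univ.filter (fun y : V₁ => y ∈ v₁)).card := by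
    rw [Nat.card_eq_fintype_card, ← Set.toFinset_card]
    congr 1
    ext y
    simp
  have h0 : ∀ x, (Finset.univ.filter (fun y : V₁ => (x, y) ∈ E)).card = w₀ := by
    intro x
    rw [← hreg₀ x, Nat.card_eq_fintype_card, ← Set.toFinset_card]
    congr 1
    ext y
    simp
  have h1 : ∀ y, (Finset.univ.filter (fun x : V₀ => (x, y) ∈ E)).card = w₁ := by
    intro y
    rw [← hreg₁ y, Nat.card_eq_fintype_card, ← Set.toFinset_card]
    congr 1
    ext x
    simp
  have hsum : ∑ x, degIn E v₁ x = w₁ * Nat.card v₁ := by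
    have := Finset.sum_card_bipartiteAbove_eq_sum_card_bipartiteBelow
      (s := (Finset.univ : Finset V₀)) (t := Finset.univ.filter (fun y : V₁ => y ∈ v₁))
      (fun x y => (x, y) ∈ E)
    simp only [Finset.bipartiteAbove, Finset.bipartiteBelow, h1, Finset.filter_filter,
      Finset.sum_const, smul_eq_mul] at this
    simp only [hdeg, this, hcv]
    ring
  have hsumR : ∑ x, (degIn E v₁ x : ℝ) = (w₁ : ℝ) * (Nat.card v₁ : ℝ) := by
    exact_mod_cast hsum
  set S : Finset V₀ := Finset.univ.filter (fun x => ε * w₀ < (degIn E v₁ x : ℝ)) with hS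
  have hScard : (S.card : ℝ) ≤ (w₁ : ℝ) * (Nat.card v₁ : ℝ) := by
    rw [← hsumR]
    calc (S.card : ℝ) = ∑ x ∈ S, (1:ℝ) := by simp
      _ ≤ ∑ x ∈ S, (degIn E v₁ x : ℝ) := by
        apply Finset.sum_le_sum
        intro x hx
        have := (Finset.mem_filter.mp hx).2
        linarith
      _ ≤ _ := Finset.sum_le_sum_of_subset_of_nonneg (Finset.subset_univ _)
        (fun _ _ _ => Nat.cast_nonneg _)
  have hexp := hlossless (S : Set V₀) (by
    have : Nat.card (S : Set V₀) = S.card := by simp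
    rw [this]
    linarith)
  have hSc : Nat.card (S : Set V₀) = S.card := by simp
  rw [hSc] at hexp
  have hN : Nat.card (Nbhd E (S : Set V₀)) ≤ Nat.card v₁
      + ∑ x ∈ S, (Finset.univ.filter (fun y : V₁ => y ∉ v₁ ∧ (x, y) ∈ E)).card := by
    rw [hcv, Nat.card_eq_fintype_card, ← Set.toFinset_card]
    refine le_trans (Finset.card_le_card (t := (Finset.univ.filter (fun y : V₁ => y ∈ v₁)) ∪
      S.biUnion (fun x => Finset.univ.filter (fun y : V₁ => y ∉ v₁ ∧ (x, y) ∈ E))) ?_) ?_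
    · intro y hy
      rw [Set.mem_toFinset] at hy
      obtain ⟨x, hx, hxy⟩ := hy
      by_cases hyv : y ∈ v₁
      · exact Finset.mem_union_left _ (by simp [hyv])
      · apply Finset.mem_union_right
        rw [Finset.mem_biUnion]
        exact ⟨x, hx, by simp [hyv, hxy]⟩
    · exact (Finset.card_union_le _ _).trans (Nat.add_le_add_left Finset.card_biUnion_le _)
  have hsplit : ∀ x, ((Finset.univ.filter (fun y : V₁ => y ∉ v₁ ∧ (x, y) ∈ E)).card : ℝ)
      = w₀ - degIn E v₁ x := by
    intro x
    have := Finset.card_filter_add_card_filter_not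
      (s := Finset.univ.filter (fun y : V₁ => (x, y) ∈ E)) (fun y => y ∈ v₁)
    rw [Finset.filter_filter, Finset.filter_filter, h0] at this
    rw [hdeg, ← this]
    simp only [and_comm]
    push_cast
    ring
  have hNR : (Nat.card (Nbhd E (S : Set V₀)) : ℝ) ≤ Nat.card v₁
      + ∑ x ∈ S, ((w₀ : ℝ) - degIn E v₁ x) := by
    simp only [← hsplit]
    exact_mod_cast hN
  rw [Finset.sum_sub_distrib, Finset.sum_const, nsmul_eq_mul] at hNR
  refine ⟨fun x => max ((degIn E v₁ x : ℝ) - ε * w₀) 0,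
    fun x => min (degIn E v₁ x : ℝ) (ε * w₀), fun x => le_max_right _ _,
    fun x => le_min (Nat.cast_nonneg _) (by linarith), ?_, ?_, fun x => min_le_right _ _, ?_⟩
  · intro x
    rcases le_total (degIn E v₁ x : ℝ) (ε * w₀) with h | h
    · simp [h]
    · simp [h]
  · have : ∑ x, max ((degIn E v₁ x : ℝ) - ε * w₀) 0
        = ∑ x ∈ S, ((degIn E v₁ x : ℝ) - ε * w₀) := by
      rw [hS, Finset.sum_filter]
      apply Finset.sum_congr rfl
      intro x _
      split_ifs with h
      · exact max_eq_left (by linarith)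
      · exact max_eq_right (by linarith)
    rw [this, Finset.sum_sub_distrib, Finset.sum_const, nsmul_eq_mul]
    linarith
  · rw [← hsumR]
    exact Finset.sum_le_sum (fun x _ => min_le_left _ _)
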